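/- arXiv:1206.3977 — 2 statements merged into one kernel-verified Lean document; each statement's English description precedes it below -/
import Mathlib

section
/- Let S = K[x_1,...,x_n] be a polynomial ring over a field K, and let J ⊊ I be two square-free monomial ideals with I generated in degrees ≥ d and J generated in degrees ≥ d+1. Then depth_S(I/J) ≥ d. -/
open MvPolynomial

/-- A squarefree exponent vector. -/
def IsSqfree {n : ℕ} (m : Fin n →₀ ℕ) : Prop := ∀ j, m j ≤ 1

/-- Total degree of an exponent vector. -/
def mdeg {n : ℕ} (m : Fin n →₀ ℕ) : ℕ := m.sum fun _ e => e

/-- `I` is generated by squarefree monomials of degree `≥ d`. -/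
def GenSqfreeGe (K : Type*) [Field K] {n : ℕ} (d : ℕ)
    (I : Ideal (MvPolynomial (Fin n) K)) : Prop :=
  ∃ G : Set (Fin n →₀ ℕ), (∀ m ∈ G, IsSqfree m ∧ d ≤ mdeg m) ∧
    I = Ideal.span ((fun m => monomial m (1 : K)) '' G)

/-- `ρ_t(I \ J)`: the number of squarefree monomials of degree `t` in `I \ J`. -/
noncomputable def rho (K : Type*) [Field K] {n : ℕ}
    (I J : Ideal (MvPolynomial (Fin n) K)) (t : ℕ) : ℕ :=
  Set.ncard {m : Fin n →₀ ℕ | IsSqfree m ∧ mdeg m = t ∧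
    monomial m (1 : K) ∈ I ∧ monomial m (1 : K) ∉ J}

/-- The `S`-module `I/J`. -/
abbrev quotMod {K : Type*} [Field K] {n : ℕ}
    (I J : Ideal (MvPolynomial (Fin n) K)) :=
  I ⧸ (Submodule.comap I.subtype (J : Submodule (MvPolynomial (Fin n) K) (MvPolynomial (Fin n) K)))

/-- Depth of a module over `K[x_1,…,x_n]` w.r.t. the maximal graded ideal
`(x_1,…,x_n)`: the supremum of lengths of regular sequences on `M` from it. -/
noncomputable def mdepth (K : Type*) [Field K] (n : ℕ)
    (M : Type*) [AddCommGroup M] [Module (MvPolynomial (Fin n) K) M] : ℕ :=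
  sSup {k | ∃ rs : List (MvPolynomial (Fin n) K), rs.length = k ∧
    (∀ r ∈ rs, r ∈ Ideal.span (Set.range (X : Fin n → MvPolynomial (Fin n) K))) ∧
    RingTheory.Sequence.IsRegular M rs}

universe u

open CategoryTheory Abelian in
/-- Vanishing of `Ext` in a given degree passes to extensions in the second variable. -/
lemma subsingleton_ext_of_exact {R : Type u} [CommRing R] {A B C : Type u}
    [AddCommGroup A] [AddCommGroup B] [AddCommGroup C] [Module R A] [Module R B] [Module R C]
    (f : A →ₗ[R] B) (g : B →ₗ[R] C) (hf : Function.Injective f) (hg : Function.Surjective g)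
    (hfg : Function.Exact f g) (N : ModuleCat.{u} R) (i : ℕ)
    (hA : Subsingleton (Ext N (ModuleCat.of R A) i))
    (hC : Subsingleton (Ext N (ModuleCat.of R C) i)) :
    Subsingleton (Ext N (ModuleCat.of R B) i) := by
  have hS := ModuleCat.shortComplex_shortExact
    (ModuleCat.shortComplexOfCompEqZero f g hfg.linearMap_comp_eq_zero) hfg hf hg
  refine subsingleton_of_forall_eq 0 fun x => ?_
  obtain ⟨y, rfl⟩ := Ext.covariant_sequence_exact₂ N hS x (hC.elim _ _)
  rw [hA.elim y 0, Ext.zero_comp]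

/-- On a finite module, a regular sequence cannot be longer than the dimension. -/
lemma length_le_supportDim_of_isRegular {R M : Type*} [CommRing R] [AddCommGroup M] [Module R M]
    [Module.Finite R M] (rs : List R) (h : RingTheory.Sequence.IsRegular M rs) :
    (rs.length : WithBot ℕ∞) ≤ Module.supportDim R M := by
  induction rs generalizing M with
  | nil =>
    have := h.nontrivial
    simpa [Module.supportDim] using Order.krullDim_nonneg_iff.mpr
      (Module.nonempty_support_of_nontrivial (R := R) (M := M)).to_subtype
  | cons r rs ih =>
    rw [RingTheory.Sequence.isRegular_cons_iff] at h
    refine le_trans ?_ (Module.supportDim_quotSMulTop_succ_le_of_notMem_minimalPrimes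
      (fun _ ↦ h.1.notMem_of_mem_minimalPrimes))
    push_cast [List.length_cons]
    gcongr
    exact ih h.2

/-- The lengths of regular sequences on a finite module over a polynomial ring are bounded. -/
lemma length_le_of_isRegular {K : Type*} [Field K] {n : ℕ} {M : Type*} [AddCommGroup M]
    [Module (MvPolynomial (Fin n) K) M] [Module.Finite (MvPolynomial (Fin n) K) M]
    (rs : List (MvPolynomial (Fin n) K)) (h : RingTheory.Sequence.IsRegular M rs) :
    rs.length ≤ n := by
  have := (length_le_supportDim_of_isRegular rs h).trans
    (Module.supportDim_le_ringKrullDim (MvPolynomial (Fin n) K) M)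
  rw [MvPolynomial.ringKrullDim_of_isNoetherianRing, ringKrullDim_eq_zero_of_field, zero_add,
    Nat.card_fin] at this
  exact_mod_cast this

lemma le_mdepth_of_isRegular {K : Type*} [Field K] {n : ℕ} {M : Type*} [AddCommGroup M]
    [Module (MvPolynomial (Fin n) K) M] [Module.Finite (MvPolynomial (Fin n) K) M]
    (rs : List (MvPolynomial (Fin n) K))
    (hrs : ∀ r ∈ rs, r ∈ Ideal.span (Set.range (X : Fin n → MvPolynomial (Fin n) K)))
    (h : RingTheory.Sequence.IsRegular M rs) :
    rs.length ≤ mdepth K n M := by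
  refine le_csSup ⟨n, ?_⟩ ⟨rs, rfl, hrs, h⟩
  rintro _ ⟨rs, rfl, -, h⟩
  exact length_le_of_isRegular rs h

lemma X_mul_mem_span_X_image_iff {K : Type*} [Field K] {n : ℕ} {T : Set (Fin n)} {j : Fin n}
    (hj : j ∉ T) (f : MvPolynomial (Fin n) K) :
    X j * f ∈ Ideal.span (X '' T : Set (MvPolynomial (Fin n) K)) ↔
      f ∈ Ideal.span (X '' T : Set (MvPolynomial (Fin n) K)) := by
  refine ⟨fun h => ?_, Ideal.mul_mem_left _ _⟩
  rw [mem_ideal_span_X_image] at h ⊢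
  intro m hm
  obtain ⟨i, hi, hmi⟩ := h (Finsupp.single j 1 + m) (by
    rw [mem_support_iff] at hm ⊢
    rwa [coeff_X_mul])
  refine ⟨i, hi, ?_⟩
  have : j ≠ i := fun e => hj (e ▸ hi)
  simpa [Finsupp.single_apply, this] using hmi

lemma ofList_map_X {K : Type*} [Field K] {n : ℕ} (l : List (Fin n)) :
    Ideal.ofList (l.map (X : Fin n → MvPolynomial (Fin n) K)) = Ideal.span (X '' {i | i ∈ l}) := by
  unfold Ideal.ofList
  congr 1
  ext
  simp

lemma isWeaklyRegular_map_X {K : Type*} [Field K] {n : ℕ} (l : List (Fin n)) (hl : l.Nodup) :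
    RingTheory.Sequence.IsWeaklyRegular (MvPolynomial (Fin n) K)
      (l.map (X : Fin n → MvPolynomial (Fin n) K)) := by
  refine ⟨fun i hi => ?_⟩
  rw [List.length_map] at hi
  rw [isSMulRegular_iff_right_eq_zero_of_smul]
  intro x hx
  obtain ⟨f, rfl⟩ := Submodule.Quotient.mk_surjective _ x
  rw [← Submodule.Quotient.mk_smul, Submodule.Quotient.mk_eq_zero] at hx
  rw [Submodule.Quotient.mk_eq_zero]
  rw [← List.map_take, ofList_map_X, smul_eq_mul, Ideal.mul_top] at hx ⊢
  rw [List.getElem_map, smul_eq_mul, X_mul_mem_span_X_image_iff] at hx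
  · exact hx
  · intro h
    obtain ⟨k, hk, hki⟩ := List.mem_iff_getElem.mp h
    rw [List.getElem_take, hl.getElem_inj_iff] at hki
    rw [List.length_take] at hk
    omega

lemma coeff_zero_of_sub_one_mem {K : Type*} [Field K] {n : ℕ} {r : MvPolynomial (Fin n) K}
    (hr : r - 1 ∈ Ideal.span (Set.range (X : Fin n → MvPolynomial (Fin n) K))) :
    coeff 0 r = 1 := by
  rw [← Set.image_univ, mem_ideal_span_X_image] at hr
  by_contra h
  obtain ⟨i, -, hi⟩ := hr 0 (by
    rw [mem_support_iff, coeff_sub, coeff_zero_one]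
    exact sub_ne_zero.mpr h)
  simp at hi

/-- Nakayama's lemma for a finite module over a polynomial ring and the irrelevant ideal. -/
lemma span_X_smul_top_lt_top {K : Type*} [Field K] {n : ℕ} {M : Type*} [AddCommGroup M]
    [Module (MvPolynomial (Fin n) K) M] [Module.Finite (MvPolynomial (Fin n) K) M] (u : M)
    (hu : ∀ r : MvPolynomial (Fin n) K, coeff 0 r = 1 → r • u ≠ 0) :
    Ideal.span (Set.range (X : Fin n → MvPolynomial (Fin n) K)) •
      (⊤ : Submodule (MvPolynomial (Fin n) K) M) < ⊤ := by
  rw [lt_top_iff_ne_top]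
  intro h
  obtain ⟨r, hr, hrM⟩ := Submodule.exists_sub_one_mem_and_smul_eq_zero_of_fg_of_le_smul
    _ ⊤ Module.Finite.fg_top h.ge
  exact hu r (coeff_zero_of_sub_one_mem hr) (hrM u trivial)

open CategoryTheory Abelian in
/-- The residue field of the irrelevant ideal has no `Ext` into `S/(x_i : i ∈ T)` in degrees
below the number of remaining variables. -/
lemma subsingleton_ext_quotient_span_X {K : Type u} [Field K] {n : ℕ} (T : Finset (Fin n)) (i : ℕ)
    (hi : i < Tᶜ.card) :
    Subsingleton (Ext
      (ModuleCat.of (MvPolynomial (Fin n) K) (MvPolynomial (Fin n) K ⧸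
        Ideal.span (Set.range (X : Fin n → MvPolynomial (Fin n) K))))
      (ModuleCat.of (MvPolynomial (Fin n) K) (MvPolynomial (Fin n) K ⧸
        Ideal.span (X '' (T : Set (Fin n)) : Set (MvPolynomial (Fin n) K)))) i) := by
  set S := MvPolynomial (Fin n) K
  have hnd : (T.toList ++ Tᶜ.toList).Nodup := by
    refine List.nodup_append'.mpr ⟨T.nodup_toList, Tᶜ.nodup_toList, ?_⟩
    intro a ha hb
    simp_all
  have hw := isWeaklyRegular_map_X (K := K) _ hnd
  rw [List.map_append, RingTheory.Sequence.isWeaklyRegular_append_iff] at hw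
  have hw := hw.2
  have e : Ideal.ofList (T.toList.map (X : Fin n → S)) • (⊤ : Submodule S S) =
      Ideal.span (X '' (T : Set (Fin n)) : Set S) := by
    rw [ofList_map_X, smul_eq_mul, Ideal.mul_top]
    simp only [Finset.mem_toList]
    rfl
  rw [e] at hw
  have hmem : ∀ r ∈ Tᶜ.toList.map (X : Fin n → S),
      r ∈ Ideal.span (Set.range (X : Fin n → S)) := by
    intro r hr
    obtain ⟨j, -, rfl⟩ := List.mem_map.mp hr
    exact Ideal.subset_span ⟨j, rfl⟩
  have hlt : Ideal.span (Set.range (X : Fin n → S)) •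
      (⊤ : Submodule S (S ⧸ Ideal.span (X '' (T : Set (Fin n)) : Set S))) < ⊤ := by
    refine span_X_smul_top_lt_top (Submodule.Quotient.mk 1) fun r hr h => ?_
    rw [← Submodule.Quotient.mk_smul, Submodule.Quotient.mk_eq_zero, smul_eq_mul, mul_one,
      mem_ideal_span_X_image] at h
    obtain ⟨j, -, hj⟩ := h 0 (by simp [mem_support_iff, hr])
    simp at hj
  refine ModuleCat.subsingleton_ext_of_exists_isRegular
    (Ideal.span (Set.range (X : Fin n → S))) _ ?_ _ hlt _ hmem ⟨hw, fun h => ?_⟩ i (by simpa)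
  · rw [Module.support_eq_zeroLocus, Ideal.annihilator_quotient]
  · exact absurd (h.le.trans (Submodule.smul_mono_left (Ideal.span_le.mpr hmem))) hlt.not_ge

open CategoryTheory Abelian in
/-- Vanishing of `Ext` into `I/J` from vanishing into `I/(J + (u))` and `S/(J : u)`. -/
lemma subsingleton_ext_quotMod {K : Type u} [Field K] {n : ℕ}
    (I J P : Ideal (MvPolynomial (Fin n) K)) (u : MvPolynomial (Fin n) K) (hu : u ∈ I)
    (hP : ∀ f, f * u ∈ J ↔ f ∈ P) (N : ModuleCat.{u} (MvPolynomial (Fin n) K)) (i : ℕ)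
    (h₁ : Subsingleton (Ext N (ModuleCat.of _ (MvPolynomial (Fin n) K ⧸ P)) i))
    (h₂ : Subsingleton (Ext N (ModuleCat.of _ (quotMod I (J ⊔ Ideal.span {u}))) i)) :
    Subsingleton (Ext N (ModuleCat.of _ (quotMod I J)) i) := by
  let f : (MvPolynomial (Fin n) K ⧸ P) →ₗ[MvPolynomial (Fin n) K] quotMod I J :=
    Submodule.liftQ P (LinearMap.toSpanSingleton _ (quotMod I J) (Submodule.Quotient.mk ⟨u, hu⟩))
      fun r hr => by
        rw [LinearMap.mem_ker, LinearMap.toSpanSingleton_apply, ← Submodule.Quotient.mk_smul,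
          Submodule.Quotient.mk_eq_zero]
        exact (hP r).mpr hr
  let g : quotMod I J →ₗ[MvPolynomial (Fin n) K] quotMod I (J ⊔ Ideal.span {u}) :=
    Submodule.factor (Submodule.comap_mono le_sup_left)
  refine subsingleton_ext_of_exact f g ?_ ?_ ?_ N i h₁ h₂
  · rw [injective_iff_map_eq_zero]
    intro x hx
    obtain ⟨r, rfl⟩ := Submodule.Quotient.mk_surjective _ x
    rw [Submodule.liftQ_apply, LinearMap.toSpanSingleton_apply, ← Submodule.Quotient.mk_smul,
      Submodule.Quotient.mk_eq_zero] at hx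
    rw [Submodule.Quotient.mk_eq_zero]
    exact (hP r).mp hx
  · exact Submodule.factor_surjective _
  · intro x
    obtain ⟨⟨y, hy⟩, rfl⟩ := Submodule.Quotient.mk_surjective _ x
    have hg : g (Submodule.Quotient.mk ⟨y, hy⟩) = 0 ↔ y ∈ J ⊔ Ideal.span {u} :=
      Submodule.Quotient.mk_eq_zero _
    rw [hg, sup_comm, Ideal.mem_span_singleton_sup]
    constructor
    · rintro ⟨a, b, hb, rfl⟩
      refine ⟨Submodule.Quotient.mk a, ?_⟩
      rw [Submodule.liftQ_apply, LinearMap.toSpanSingleton_apply, ← Submodule.Quotient.mk_smul,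
        Submodule.Quotient.eq]
      simpa using hb
    · rintro ⟨z, hz⟩
      obtain ⟨a, rfl⟩ := Submodule.Quotient.mk_surjective _ z
      rw [Submodule.liftQ_apply, LinearMap.toSpanSingleton_apply, ← Submodule.Quotient.mk_smul,
        Submodule.Quotient.eq] at hz
      refine ⟨a, y - a * u, ?_, by ring⟩
      rw [← neg_sub]
      exact J.neg_mem hz

lemma finite_setOf_isSqfree (n : ℕ) : {m : Fin n →₀ ℕ | IsSqfree m}.Finite := by
  refine (Set.finite_Iic (Finsupp.equivFunOnFinite.symm fun _ => 1 : Fin n →₀ ℕ)).subset ?_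
  intro m hm j
  exact hm j

lemma mdeg_eq_card_support {n : ℕ} {m : Fin n →₀ ℕ} (hm : IsSqfree m) :
    mdeg m = m.support.card := by
  rw [mdeg, Finsupp.sum, Finset.card_eq_sum_ones]
  refine Finset.sum_congr rfl fun j hj => ?_
  have := hm j
  have := Finsupp.mem_support_iff.mp hj
  omega

lemma mdeg_mono {n : ℕ} {m m' : Fin n →₀ ℕ} (h : m ≤ m') : mdeg m ≤ mdeg m' :=
  Finsupp.degree_mono h

lemma monomial_mem_span_iff {K : Type*} [Field K] {n : ℕ} {G : Set (Fin n →₀ ℕ)}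
    {m : Fin n →₀ ℕ} :
    monomial m (1 : K) ∈ Ideal.span ((fun m => monomial m (1 : K)) '' G) ↔ ∃ g ∈ G, g ≤ m := by
  classical
  rw [mem_ideal_span_monomial_image, support_monomial, if_neg one_ne_zero]
  simp

/-- The colon ideal of a squarefree monomial ideal by a squarefree monomial which is maximal
outside the ideal is generated by the variables not dividing this monomial. -/
lemma mul_monomial_mem_span_iff {K : Type*} [Field K] {n : ℕ} {G : Set (Fin n →₀ ℕ)}
    (hG : ∀ m ∈ G, IsSqfree m) {F : Fin n →₀ ℕ}
    (hFG : ∀ g ∈ G, ¬ g ≤ F)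
    (hmax : ∀ j, F j = 0 → ∃ g ∈ G, g ≤ F + Finsupp.single j 1) (f : MvPolynomial (Fin n) K) :
    f * monomial F 1 ∈ Ideal.span ((fun m => monomial m (1 : K)) '' G) ↔
      f ∈ Ideal.span (X '' ((F.supportᶜ : Finset (Fin n)) : Set (Fin n)) :
        Set (MvPolynomial (Fin n) K)) := by
  rw [mem_ideal_span_monomial_image, mem_ideal_span_X_image]
  constructor
  · intro h m hm
    obtain ⟨g, hg, hgm⟩ := h (m + F) (by
      rw [mem_support_iff] at hm ⊢
      rwa [coeff_mul_monomial, mul_one])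
    by_contra! hcon
    refine hFG g hg fun j => ?_
    by_cases hj : F j = 0
    · have h1 := hgm j
      have h2 := hcon j (by simp [hj])
      simp only [Finsupp.add_apply] at h1
      omega
    · have := hG g hg j
      omega
  · intro h m hm
    rw [mem_support_iff, coeff_mul_monomial'] at hm
    split_ifs at hm with hFm
    · rw [mul_one] at hm
      obtain ⟨j, hj, hmj⟩ := h (m - F) (mem_support_iff.mpr hm)
      have hFj : F j = 0 := by simpa using hj
      obtain ⟨g, hg, hgF⟩ := hmax j hFj
      refine ⟨g, hg, hgF.trans fun k => ?_⟩
      have := hFm k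
      simp only [Finsupp.add_apply, Finsupp.single_apply]
      split_ifs with hjk
      · subst hjk
        simp only [Finsupp.tsub_apply] at hmj
        omega
      · simpa using this
    · exact absurd rfl hm

open CategoryTheory Abelian in
lemma subsingleton_ext_quotMod_span {K : Type u} [Field K] {n d : ℕ} (GI GJ : Set (Fin n →₀ ℕ))
    (hGI : ∀ m ∈ GI, IsSqfree m ∧ d ≤ mdeg m) (hGJ : ∀ m ∈ GJ, IsSqfree m) (i : ℕ) (hi : i < d) :
    Subsingleton (Ext
      (ModuleCat.of (MvPolynomial (Fin n) K) (MvPolynomial (Fin n) K ⧸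
        Ideal.span (Set.range (X : Fin n → MvPolynomial (Fin n) K))))
      (ModuleCat.of _ (quotMod (Ideal.span ((fun m => monomial m (1 : K)) '' GI))
        (Ideal.span ((fun m => monomial m (1 : K)) '' GJ)))) i) := by
  induction hk : {m : Fin n →₀ ℕ | IsSqfree m ∧ (∃ g ∈ GI, g ≤ m) ∧ ∀ g ∈ GJ, ¬ g ≤ m}.ncard
    using Nat.strong_induction_on generalizing GJ with
  | _ k ih =>
    set A := {m : Fin n →₀ ℕ | IsSqfree m ∧ (∃ g ∈ GI, g ≤ m) ∧ ∀ g ∈ GJ, ¬ g ≤ m}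
    have hfin : A.Finite := (finite_setOf_isSqfree n).subset fun m hm => hm.1
    obtain hemp | hne := A.eq_empty_or_nonempty
    · have hle : Ideal.span ((fun m => monomial m (1 : K)) '' GI) ≤
          Ideal.span ((fun m => monomial m (1 : K)) '' GJ) := by
        rw [Ideal.span_le]
        rintro _ ⟨m, hm, rfl⟩
        rw [SetLike.mem_coe, monomial_mem_span_iff]
        by_contra! hcon
        exact Set.eq_empty_iff_forall_notMem.mp hemp m ⟨(hGI m hm).1, ⟨m, hm, le_rfl⟩, hcon⟩
      have : Subsingleton (quotMod (Ideal.span ((fun m => monomial m (1 : K)) '' GI))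
          (Ideal.span ((fun m => monomial m (1 : K)) '' GJ))) := by
        rw [Submodule.Quotient.subsingleton_iff, eq_top_iff]
        exact fun x _ => hle x.2
      have hz : Limits.IsZero (ModuleCat.of (MvPolynomial (Fin n) K)
          (quotMod (Ideal.span ((fun m => monomial m (1 : K)) '' GI))
          (Ideal.span ((fun m => monomial m (1 : K)) '' GJ)))) :=
        ModuleCat.isZero_of_iff_subsingleton.mpr this
      refine subsingleton_of_forall_eq 0 fun x => ?_
      rw [← Ext.comp_mk₀_id x, hz.eq_of_src (𝟙 _) 0, Ext.mk₀_zero, Ext.comp_zero]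
    · obtain ⟨F, hFA, hFmax⟩ := hfin.exists_maximal hne
      obtain ⟨hFsq, ⟨g₀, hg₀, hg₀F⟩, hFG⟩ := hFA
      have hcolon := mul_monomial_mem_span_iff (K := K) hGJ hFG fun j hj => by
        by_contra! hcon
        have := hFmax (y := F + Finsupp.single j 1) ⟨fun k => ?_, ⟨g₀, hg₀,
          hg₀F.trans le_self_add⟩, hcon⟩ le_self_add j
        · simp [hj] at this
        · have := hFsq k
          simp only [Finsupp.add_apply, Finsupp.single_apply]
          split_ifs with hjk
          · subst hjk; omega
          · omega
      refine subsingleton_ext_quotMod _ _ _ (monomial F 1) ?_ hcolon _ i ?_ ?_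
      · exact monomial_mem_span_iff.mpr ⟨g₀, hg₀, hg₀F⟩
      · refine subsingleton_ext_quotient_span_X _ i ?_
        rw [compl_compl, ← mdeg_eq_card_support hFsq]
        exact hi.trans_le ((hGI g₀ hg₀).2.trans (mdeg_mono hg₀F))
      · have hins : Ideal.span ((fun m => monomial m (1 : K)) '' GJ) ⊔
            Ideal.span {monomial F 1} =
            Ideal.span ((fun m => monomial m (1 : K)) '' (insert F GJ)) := by
          rw [Set.image_insert_eq, Ideal.span_insert, sup_comm]
        rw [hins]
        refine ih _ ?_ (insert F GJ) ?_ rfl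
        · rw [← hk]
          refine Set.ncard_lt_ncard ⟨?_, fun hsub => ?_⟩ hfin
          · exact fun m hm => ⟨hm.1, hm.2.1, fun g hg => hm.2.2 g (Or.inr hg)⟩
          · exact (hsub ⟨hFsq, ⟨g₀, hg₀, hg₀F⟩, hFG⟩).2.2 F (Or.inl rfl) le_rfl
        · rintro m (rfl | hm)
          · exact hFsq
          · exact hGJ m hm

theorem depth_ge_d {K : Type*} [Field K] {n d : ℕ}
    (I J : Ideal (MvPolynomial (Fin n) K)) (hJI : J < I)
    (hI : GenSqfreeGe K d I) (hJ : GenSqfreeGe K (d + 1) J) :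
    d ≤ mdepth K n (quotMod I J) := by
  obtain ⟨GI, hGI, rfl⟩ := hI
  obtain ⟨GJ, hGJ, rfl⟩ := hJ
  obtain ⟨m, hm, hmJ⟩ : ∃ m ∈ GI, monomial m (1 : K) ∉
      Ideal.span ((fun m => monomial m (1 : K)) '' GJ) := by
    by_contra! h
    refine hJI.not_ge (Ideal.span_le.mpr ?_)
    rintro _ ⟨m, hm, rfl⟩
    exact h m hm
  have hlt := span_X_smul_top_lt_top (K := K) (n := n) (M := quotMod
      (Ideal.span ((fun m => monomial m (1 : K)) '' GI))
      (Ideal.span ((fun m => monomial m (1 : K)) '' GJ)))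
    (Submodule.Quotient.mk ⟨monomial m 1, Ideal.subset_span (Set.mem_image_of_mem _ hm)⟩)
    fun r hr h => by
      rw [← Submodule.Quotient.mk_smul, Submodule.Quotient.mk_eq_zero] at h
      replace h : r * monomial m 1 ∈ Ideal.span ((fun m => monomial m (1 : K)) '' GJ) := h
      rw [mem_ideal_span_monomial_image] at h
      exact hmJ (monomial_mem_span_iff.mpr (h m (by
        rw [mem_support_iff, coeff_mul_monomial']
        simp [hr])))
  obtain ⟨rs, rfl, hrs, hreg⟩ := ModuleCat.exists_isRegular_of_exists_subsingleton_ext _ d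
    (ModuleCat.of _ _) hlt
    (ModuleCat.of (MvPolynomial (Fin n) K) (MvPolynomial (Fin n) K ⧸
      Ideal.span (Set.range (X : Fin n → MvPolynomial (Fin n) K))))
    (by rw [Module.support_eq_zeroLocus, Ideal.annihilator_quotient])
    (subsingleton_ext_quotMod_span GI GJ hGI fun m hm => (hGJ m hm).1)
  exact le_mdepth_of_isRegular rs hrs hreg
end

section
/- With notation as above (h maps built from incidence-with-signs matrices between square-free monomials of consecutive degrees in I\J), if depth_S(I/J) > d+i then the complex K^c → K^r → K^s given by h_{n-d-i+1} and h_{n-d-i} is exact at K^r. -/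
open MvPolynomial

open Classical in
/-- The Koszul sign: if `b = f · x_j` this is the sign with which `x_j e_{σ_f}`
appears in `∂(e_{τ_b})`, where `e_σ` for a squarefree monomial is the wedge of the
`e_l` over `l` outside its support; otherwise `0`. -/
noncomputable def kSign (K : Type*) [Field K] {n : ℕ} (f b : Fin n →₀ ℕ) : K :=
  if h : ∃ j, b = f + Finsupp.single j 1 then
    (-1 : K) ^ (Finset.univ.filter (fun l : Fin n => f l = 0 ∧ l < h.choose)).card
  else 0

/-- The sign attached to exchanging `j` with the elements outside `T` that precede it. -/
def complSign {n : ℕ} (T : Finset (Fin n)) (j : Fin n) : ℤ :=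
  (-1) ^ (Finset.univ.filter fun l : Fin n => l ∉ T ∧ l < j).card

/-- Left multiplication by the `j`-th exterior generator. -/
def wedgeGen {n : ℕ} {M : Type*} [AddCommGroup M] (j : Fin n) (z : Finset (Fin n) → M) :
    Finset (Fin n) → M :=
  fun T => if j ∈ T then complSign T j • z (T.erase j) else 0

/-- Contraction against the `j`-th exterior generator. -/
def contractGen {n : ℕ} {M : Type*} [AddCommGroup M] (j : Fin n) (z : Finset (Fin n) → M) :
    Finset (Fin n) → M :=
  fun T => if j ∈ T then 0 else complSign T j • z (insert j T)

/-- The differential of the cohomological Koszul complex of `x` with coefficients in `M`. -/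
def koszulD {n : ℕ} {R M : Type*} [CommRing R] [AddCommGroup M] [Module R M]
    (x : Fin n → R) (z : Finset (Fin n) → M) : Finset (Fin n) → M :=
  fun T => ∑ j, x j • wedgeGen j z T

section Koszul

variable {n : ℕ}

lemma complSign_mul_self (T : Finset (Fin n)) (j : Fin n) :
    complSign T j * complSign T j = 1 := by
  simp [complSign, ← mul_pow]

lemma complSign_erase_of_le {T : Finset (Fin n)} {i j : Fin n} (h : i ≤ j) :
    complSign (T.erase j) i = complSign T i := by
  unfold complSign
  congr 2
  ext l
  simp only [Finset.mem_filter, Finset.mem_univ, true_and, Finset.mem_erase]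
  constructor
  · rintro ⟨h1, h2⟩
    exact ⟨fun h3 => h1 ⟨(h2.trans_le h).ne, h3⟩, h2⟩
  · rintro ⟨h1, h2⟩
    exact ⟨fun h3 => h1 h3.2, h2⟩

lemma complSign_erase_of_lt {T : Finset (Fin n)} {i j : Fin n} (hj : j ∈ T) (h : j < i) :
    complSign (T.erase j) i = -complSign T i := by
  unfold complSign
  have : (Finset.univ.filter fun l : Fin n => l ∉ T.erase j ∧ l < i) =
      insert j (Finset.univ.filter fun l : Fin n => l ∉ T ∧ l < i) := by
    ext l
    simp only [Finset.mem_filter, Finset.mem_univ, true_and, Finset.mem_erase, Finset.mem_insert]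
    by_cases hl : l = j
    · subst hl; simp [h]
    · simp [hl]
  rw [this, Finset.card_insert_of_notMem (by simp [hj]), pow_succ]
  ring

lemma complSign_insert_self (T : Finset (Fin n)) (j : Fin n) :
    complSign (insert j T) j = complSign T j := by
  rw [← complSign_erase_of_le (T := insert j T) (le_refl j)]
  by_cases h : j ∈ T
  · rw [Finset.insert_eq_of_mem h, complSign_erase_of_le le_rfl]
  · rw [Finset.erase_insert h]

lemma complSign_swap {T : Finset (Fin n)} {i j : Fin n} (hi : i ∈ T) (hj : j ∈ T) (h : i ≠ j) :
    complSign T i * complSign (T.erase i) j = -(complSign T j * complSign (T.erase j) i) := by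
  rcases lt_or_gt_of_ne h with h | h
  · rw [complSign_erase_of_lt hi h, complSign_erase_of_le h.le]; ring
  · rw [complSign_erase_of_lt hj h, complSign_erase_of_le h.le]; ring

section AddCommGroup

variable {M : Type*} [AddCommGroup M]

lemma wedgeGen_self (j : Fin n) (z : Finset (Fin n) → M) (T : Finset (Fin n)) :
    wedgeGen j (wedgeGen j z) T = 0 := by
  simp [wedgeGen]

lemma wedgeGen_comm (i j : Fin n) (z : Finset (Fin n) → M) (T : Finset (Fin n)) :
    wedgeGen i (wedgeGen j z) T + wedgeGen j (wedgeGen i z) T = 0 := by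
  by_cases h : i = j
  · subst h; simp [wedgeGen_self]
  by_cases hi : i ∈ T <;> by_cases hj : j ∈ T <;>
    simp only [wedgeGen, Finset.mem_erase, hi, hj, h, Ne.symm h, ne_eq, not_false_eq_true,
      and_true, and_false, if_true, if_false, smul_zero, add_zero, smul_smul]
  rw [complSign_swap hi hj h, Finset.erase_right_comm]
  simp

lemma wedgeGen_contractGen_self (j : Fin n) (z : Finset (Fin n) → M) (T : Finset (Fin n)) :
    wedgeGen j (contractGen j z) T + contractGen j (wedgeGen j z) T = z T := by
  by_cases hj : j ∈ T
  · simp [wedgeGen, contractGen, hj, smul_smul, complSign_erase_of_le, complSign_mul_self]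
  · simp [wedgeGen, contractGen, hj, smul_smul, complSign_insert_self, complSign_mul_self]

lemma wedgeGen_contractGen_of_ne {i j : Fin n} (h : j ≠ i) (z : Finset (Fin n) → M)
    (T : Finset (Fin n)) :
    wedgeGen j (contractGen i z) T + contractGen i (wedgeGen j z) T = 0 := by
  by_cases hi : i ∈ T <;> by_cases hj : j ∈ T <;>
    simp only [wedgeGen, contractGen, Finset.mem_erase, Finset.mem_insert, hi, hj, h, Ne.symm h,
      ne_eq, not_false_eq_true, and_true, and_false, or_true, or_false, if_true,
      if_false, smul_zero, add_zero, smul_smul]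
  have key := complSign_swap (T := insert i T) (i := i) (j := j) (by simp) (by simp [hj]) h.symm
  rw [Finset.erase_insert hi, complSign_insert_self,
    Finset.erase_insert_of_ne h.symm, complSign_insert_self] at key
  have e : complSign T j * complSign (T.erase j) i =
      -(complSign T i * complSign (insert i T) j) := by
    have h1 := complSign_mul_self T j
    have h2 := complSign_mul_self (insert i T) j
    calc _ = complSign T j * (complSign (insert i T) j * complSign (insert i T) j) *
          complSign (T.erase j) i := by rw [h2, mul_one]
      _ = complSign T j * complSign (insert i T) j *
          (complSign (insert i T) j * complSign (T.erase j) i) := by ring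
      _ = -(complSign T i * complSign (insert i T) j) * (complSign T j * complSign T j) := by
          rw [← neg_eq_iff_eq_neg.mpr key]; ring
      _ = _ := by rw [h1, mul_one]
  rw [e, Finset.erase_insert_of_ne h.symm, neg_smul, neg_add_cancel]

end AddCommGroup

section Module

variable {R M : Type*} [CommRing R] [AddCommGroup M] [Module R M]

lemma koszulD_congr (x : Fin n → R) {z z' : Finset (Fin n) → M} {T : Finset (Fin n)}
    (h : ∀ j ∈ T, z (T.erase j) = z' (T.erase j)) : koszulD x z T = koszulD x z' T := by
  refine Finset.sum_congr rfl fun j _ => ?_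
  by_cases hj : j ∈ T
  · simp [wedgeGen, hj, h j hj]
  · simp [wedgeGen, hj]

lemma koszulD_zero (x : Fin n → R) (T : Finset (Fin n)) :
    koszulD x (0 : Finset (Fin n) → M) T = 0 := by
  simp [koszulD, wedgeGen]

lemma koszulD_add (x : Fin n → R) (z z' : Finset (Fin n) → M) (T : Finset (Fin n)) :
    koszulD x (z + z') T = koszulD x z T + koszulD x z' T := by
  simp only [koszulD, ← Finset.sum_add_distrib, ← smul_add]
  refine Finset.sum_congr rfl fun j _ => ?_
  by_cases hj : j ∈ T <;> simp [wedgeGen, hj]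

lemma koszulD_smul (x : Fin n → R) (a : R) (z : Finset (Fin n) → M) (T : Finset (Fin n)) :
    koszulD x (a • z) T = a • koszulD x z T := by
  simp only [koszulD, Finset.smul_sum]
  refine Finset.sum_congr rfl fun j _ => ?_
  by_cases hj : j ∈ T
  · simp [wedgeGen, hj, smul_comm a]
  · simp [wedgeGen, hj]

lemma koszulD_map {N : Type*} [AddCommGroup N] [Module R N] (φ : M →ₗ[R] N)
    (x : Fin n → R) (z : Finset (Fin n) → M) (T : Finset (Fin n)) :
    koszulD x (fun U => φ (z U)) T = φ (koszulD x z T) := by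
  simp only [koszulD, map_sum, map_smul]
  refine Finset.sum_congr rfl fun j _ => ?_
  by_cases hj : j ∈ T <;> simp [wedgeGen, hj]

lemma wedgeGen_koszulD (x : Fin n → R) (i : Fin n) (z : Finset (Fin n) → M)
    (T : Finset (Fin n)) :
    wedgeGen i (koszulD x z) T = ∑ j, x j • wedgeGen i (wedgeGen j z) T := by
  by_cases hi : i ∈ T
  · rw [wedgeGen, if_pos hi, koszulD, Finset.smul_sum]
    refine Finset.sum_congr rfl fun j _ => ?_
    rw [smul_comm, wedgeGen.eq_def i, if_pos hi]
  · simp [wedgeGen, hi]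

lemma contractGen_koszulD (x : Fin n → R) (i : Fin n) (z : Finset (Fin n) → M)
    (T : Finset (Fin n)) :
    contractGen i (koszulD x z) T = ∑ j, x j • contractGen i (wedgeGen j z) T := by
  by_cases hi : i ∈ T
  · simp [contractGen, hi]
  · rw [contractGen, if_neg hi, koszulD, Finset.smul_sum]
    refine Finset.sum_congr rfl fun j _ => ?_
    rw [smul_comm, contractGen, if_neg hi]

lemma koszulD_koszulD (x : Fin n → R) (z : Finset (Fin n) → M) (T : Finset (Fin n)) :
    koszulD x (koszulD x z) T = 0 := by
  have h : koszulD x (koszulD x z) T =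
      ∑ p : Fin n × Fin n, (x p.1 * x p.2) • wedgeGen p.1 (wedgeGen p.2 z) T := by
    rw [Fintype.sum_prod_type, koszulD]
    simp only [wedgeGen_koszulD, Finset.smul_sum, smul_smul]
  rw [h]
  refine Finset.sum_involution (fun p _ => p.swap) (fun p _ => ?_) (fun p _ hp he => hp ?_)
    (fun _ _ => Finset.mem_univ _) (fun p _ => p.swap_swap)
  · simp only [Prod.fst_swap, Prod.snd_swap]
    rw [mul_comm (x p.2), ← smul_add, wedgeGen_comm, smul_zero]
  · have : p.2 = p.1 := congrArg Prod.fst he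
    rw [this, wedgeGen_self, smul_zero]

lemma koszulD_contractGen (x : Fin n → R) (i : Fin n) (z : Finset (Fin n) → M)
    (T : Finset (Fin n)) :
    koszulD x (contractGen i z) T + contractGen i (koszulD x z) T = x i • z T := by
  rw [contractGen_koszulD, koszulD, ← Finset.sum_add_distrib, Finset.sum_eq_single i]
  · rw [← smul_add, wedgeGen_contractGen_self]
  · intro j _ hj
    rw [← smul_add, wedgeGen_contractGen_of_ne hj, smul_zero]
  · simp

lemma exists_koszulD_eq_smul (x : Fin n → R) {p : ℕ} {z : Finset (Fin n) → M}
    (hz : ∀ T, T.card = p + 1 → koszulD x z T = 0) {a : R}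
    (ha : a ∈ Ideal.span (Set.range x)) :
    ∃ w : Finset (Fin n) → M, ∀ T, T.card = p → koszulD x w T = a • z T := by
  induction ha using Submodule.span_induction with
  | mem a ha =>
    obtain ⟨i, rfl⟩ := ha
    refine ⟨contractGen i z, fun T hT => ?_⟩
    rw [← koszulD_contractGen, left_eq_add, contractGen]
    split_ifs with hi
    · rfl
    · rw [hz _ (by rw [Finset.card_insert_of_notMem hi, hT]), smul_zero]
  | zero => exact ⟨0, fun T _ => by rw [koszulD_zero, zero_smul]⟩
  | add a b _ _ iha ihb =>
    obtain ⟨w, hw⟩ := iha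
    obtain ⟨w', hw'⟩ := ihb
    exact ⟨w + w', fun T hT => by rw [koszulD_add, hw T hT, hw' T hT, add_smul]⟩
  | smul c a _ iha =>
    obtain ⟨w, hw⟩ := iha
    exact ⟨c • w, fun T hT => by rw [koszulD_smul, hw T hT, smul_eq_mul, mul_smul]⟩

/-- Koszul cohomology vanishes in degrees below the length of a weakly regular sequence
contained in the ideal generated by `x`. -/
theorem koszulD_exact_of_isWeaklyRegular {R : Type*} [CommRing R] (x : Fin n → R) (rs : List R)
    (hrs : ∀ a ∈ rs, a ∈ Ideal.span (Set.range x)) :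
    ∀ {M : Type*} [AddCommGroup M] [Module R M], RingTheory.Sequence.IsWeaklyRegular M rs →
    ∀ {p : ℕ}, p < rs.length → ∀ {z : Finset (Fin n) → M},
    (∀ T, T.card = p + 1 → koszulD x z T = 0) →
    ∃ w : Finset (Fin n) → M, ∀ T, T.card = p → koszulD x w T = z T := by
  induction rs with
  | nil => intro M _ _ _ p hp; simp at hp
  | cons a rs ih =>
    intro M _ _ hreg p hp z hz
    obtain ⟨ha, hreg'⟩ := (RingTheory.Sequence.isWeaklyRegular_cons_iff M a rs).mp hreg
    obtain ⟨w, hw⟩ := exists_koszulD_eq_smul x hz (hrs a (by simp))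
    cases p with
    | zero =>
      refine ⟨0, fun T hT => ha ?_⟩
      change a • _ = a • _
      rw [← hw T hT, Finset.card_eq_zero.mp hT]
      simp [koszulD, wedgeGen]
    | succ p =>
      let π : M →ₗ[R] QuotSMulTop a M := Submodule.mkQ _
      obtain ⟨u', hu'⟩ := ih (fun b hb => hrs b (by simp [hb])) hreg' (p := p)
        (by simpa using hp) (z := fun T => π (w T)) (fun T hT => by
          rw [koszulD_map, hw T hT]
          exact (Submodule.Quotient.mk_eq_zero _).mpr
            (Submodule.smul_mem_pointwise_smul _ _ _ trivial))
      choose u hu using fun T => Submodule.mkQ_surjective _ (u' T)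
      have hv : ∀ T, ∃ v : M, T.card = p → w T = koszulD x u T + a • v := by
        intro T
        by_cases hT : T.card = p
        · have h1 := hu' T hT
          rw [← funext hu] at h1
          have h2 : π (w T - koszulD x u T) = 0 := by
            rw [map_sub, ← koszulD_map, sub_eq_zero]
            exact h1.symm
          obtain ⟨v, -, hv⟩ := (Submodule.mem_smul_pointwise_iff_exists _ _ _).mp
            ((Submodule.Quotient.mk_eq_zero _).mp h2)
          exact ⟨v, fun _ => by rw [hv]; abel⟩
        · exact ⟨0, fun h => absurd h hT⟩
      choose v hv using hv
      refine ⟨v, fun T hT => ha ?_⟩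
      change a • _ = a • _
      rw [← hw T hT, koszulD_congr x (z' := koszulD x u + a • v) fun j hj => hv _
        (by rw [Finset.card_erase_of_mem hj, hT]; rfl), koszulD_add, koszulD_koszulD,
        koszulD_smul, zero_add]

end Module

/-- The exponent vector of the squarefree monomial with support `T`. -/
noncomputable def sqfreeExp (T : Finset (Fin n)) : Fin n →₀ ℕ :=
  Finsupp.equivFunOnFinite.symm fun j => if j ∈ T then 1 else 0

lemma sqfreeExp_apply (T : Finset (Fin n)) (j : Fin n) :
    sqfreeExp T j = if j ∈ T then 1 else 0 := rfl

lemma sqfreeExp_injective : Function.Injective (sqfreeExp (n := n)) := by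
  intro T U h
  ext j
  have := DFunLike.congr_fun h j
  rw [sqfreeExp_apply, sqfreeExp_apply] at this
  by_cases h1 : j ∈ T <;> by_cases h2 : j ∈ U <;> simp_all

lemma isSqfree_sqfreeExp (T : Finset (Fin n)) : IsSqfree (sqfreeExp T) := by
  intro j
  rw [sqfreeExp_apply]
  split_ifs <;> simp

lemma mdeg_sqfreeExp (T : Finset (Fin n)) : mdeg (sqfreeExp T) = T.card := by
  rw [mdeg, Finsupp.sum_fintype _ _ (by simp)]
  simp [sqfreeExp_apply]

lemma IsSqfree.sqfreeExp_support {m : Fin n →₀ ℕ} (hm : IsSqfree m) :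
    sqfreeExp m.support = m := by
  ext j
  rw [sqfreeExp_apply]
  have := hm j
  split_ifs with h <;> rw [Finsupp.mem_support_iff] at h <;> omega

lemma sqfreeExp_erase_add {T : Finset (Fin n)} {j : Fin n} (hj : j ∈ T) :
    sqfreeExp (T.erase j) + Finsupp.single j 1 = sqfreeExp T := by
  ext l
  rw [Finsupp.add_apply, sqfreeExp_apply, sqfreeExp_apply, Finsupp.single_apply]
  by_cases h : j = l
  · subst h; simp [hj]
  · simp [h, Ne.symm h]

lemma sqfreeExp_eq_add_single {T : Finset (Fin n)} {m : Fin n →₀ ℕ} {j : Fin n}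
    (h : sqfreeExp T = m + Finsupp.single j 1) : j ∈ T ∧ m = sqfreeExp (T.erase j) := by
  have hj : j ∈ T := by
    by_contra hj
    have := DFunLike.congr_fun h j
    simp [sqfreeExp_apply, hj] at this
  refine ⟨hj, ?_⟩
  rw [← sqfreeExp_erase_add hj] at h
  exact (add_right_cancel h).symm

lemma kSign_sqfreeExp (K : Type*) [Field K] (m : Fin n →₀ ℕ) (T : Finset (Fin n)) :
    kSign K m (sqfreeExp T) =
      ∑ j, if j ∈ T ∧ m = sqfreeExp (T.erase j) then (complSign T j : K) else 0 := by
  unfold kSign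
  split_ifs with h
  · obtain ⟨hj, hm⟩ := sqfreeExp_eq_add_single h.choose_spec
    rw [Finset.sum_eq_single h.choose]
    · rw [if_pos ⟨hj, hm⟩, ← complSign_erase_of_le le_rfl, complSign]
      push_cast
      congr 2
      ext l
      have hml : m l = 0 ↔ l ∉ T.erase h.choose := by
        have := DFunLike.congr_fun hm l
        rw [sqfreeExp_apply] at this
        simp [this]
      rw [Finset.mem_filter, Finset.mem_filter, hml]
    · intro i _ hi
      refine if_neg fun ⟨hiT, him⟩ => hi ?_
      by_contra hne
      have := sqfreeExp_injective (him.symm.trans hm)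
      have h1 : i ∈ T.erase h.choose := Finset.mem_erase.mpr ⟨hne, hiT⟩
      rw [← this] at h1
      simp at h1
    · simp
  · refine (Finset.sum_eq_zero fun j _ => if_neg fun ⟨hj, hm⟩ => h ⟨j, ?_⟩).symm
    rw [hm, sqfreeExp_erase_add hj]

/-- Regard a vector indexed by a list of exponents as a function on subsets of the variables. -/
noncomputable def cochainOf {K : Type*} [Field K] {r : ℕ} (f : Fin r → (Fin n →₀ ℕ))
    (v : Fin r → K) (T : Finset (Fin n)) : K :=
  open Classical in ∑ q, if f q = sqfreeExp T then v q else 0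

section Field

variable {K : Type*} [Field K]

lemma cochainOf_eq {r : ℕ} {f : Fin r → (Fin n →₀ ℕ)} (hf : Function.Injective f)
    (v : Fin r → K) {T : Finset (Fin n)} {q : Fin r} (hq : f q = sqfreeExp T) :
    cochainOf f v T = v q := by
  rw [cochainOf, Finset.sum_eq_single q]
  · rw [if_pos hq]
  · intro q' _ h
    exact if_neg fun h' => h (hf (h'.trans hq.symm))
  · simp

lemma cochainOf_eq_zero {r : ℕ} {f : Fin r → (Fin n →₀ ℕ)}
    (v : Fin r → K) {T : Finset (Fin n)} (hT : sqfreeExp T ∉ Set.range f) :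
    cochainOf f v T = 0 :=
  Finset.sum_eq_zero fun q _ => if_neg fun h => hT ⟨q, h⟩

lemma sum_kSign_mul {r : ℕ} (f : Fin r → (Fin n →₀ ℕ)) (v : Fin r → K)
    (T : Finset (Fin n)) :
    ∑ q, kSign K (f q) (sqfreeExp T) * v q = koszulD (1 : Fin n → K) (cochainOf f v) T := by
  simp only [kSign_sqfreeExp, Finset.sum_mul, koszulD]
  rw [Finset.sum_comm]
  refine Finset.sum_congr rfl fun j _ => ?_
  by_cases hj : j ∈ T
  · simp only [wedgeGen, hj, true_and, if_true, cochainOf, Pi.one_apply, one_smul, zsmul_eq_mul,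
      Finset.mul_sum]
    refine Finset.sum_congr rfl fun q _ => ?_
    split_ifs <;> simp
  · simp [wedgeGen, hj]

lemma monomial_koszulD (V : Finset (Fin n) → K) (T : Finset (Fin n)) :
    koszulD (X : Fin n → MvPolynomial (Fin n) K) (fun U => monomial (sqfreeExp U) (V U)) T =
      monomial (sqfreeExp T) (koszulD (1 : Fin n → K) V T) := by
  simp only [koszulD, map_sum]
  refine Finset.sum_congr rfl fun j _ => ?_
  by_cases hj : j ∈ T
  · simp only [wedgeGen, hj, if_true, Pi.one_apply, smul_eq_mul, map_zsmul,
      mul_smul_comm]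
    rw [X, monomial_mul, one_mul, add_comm, sqfreeExp_erase_add hj]
  · simp [wedgeGen, hj]

lemma coeff_koszulD (w : Finset (Fin n) → MvPolynomial (Fin n) K) (T : Finset (Fin n)) :
    coeff (sqfreeExp T) (koszulD (X : Fin n → MvPolynomial (Fin n) K) w T) =
      koszulD (1 : Fin n → K) (fun U => coeff (sqfreeExp U) (w U)) T := by
  simp only [koszulD, coeff_sum]
  refine Finset.sum_congr rfl fun j _ => ?_
  by_cases hj : j ∈ T
  · simp only [wedgeGen, hj, if_true, Pi.one_apply, smul_eq_mul]
    rw [← sqfreeExp_erase_add hj, add_comm, coeff_X_mul, one_mul]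
    exact map_zsmul (coeffAddMonoidHom (R := K) (sqfreeExp (T.erase j))) _ _
  · simp [wedgeGen, hj]

lemma GenSqfreeGe.monomial_mem {d : ℕ} {I : Ideal (MvPolynomial (Fin n) K)}
    (hI : GenSqfreeGe K d I) {p : MvPolynomial (Fin n) K} (hp : p ∈ I) {m : Fin n →₀ ℕ}
    (hm : coeff m p ≠ 0) : monomial m (1 : K) ∈ I := by
  obtain ⟨G, -, rfl⟩ := hI
  rw [mem_ideal_span_monomial_image] at hp ⊢
  intro m' hm'
  rw [Finset.mem_singleton.mp (support_monomial_subset hm')]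
  exact hp m (mem_support_iff.mpr hm)

lemma monomial_sqfreeExp_mem_of_erase {I : Ideal (MvPolynomial (Fin n) K)}
    {T : Finset (Fin n)} {j : Fin n} (hj : j ∈ T)
    (h : monomial (sqfreeExp (T.erase j)) (1 : K) ∈ I) : monomial (sqfreeExp T) (1 : K) ∈ I := by
  rw [← sqfreeExp_erase_add hj, monomial_add_single, pow_one]
  exact I.mul_mem_right _ h

end Field

end Koszul

theorem koszul_exact {K : Type*} [Field K] {n d i c r s : ℕ}
    (I J : Ideal (MvPolynomial (Fin n) K)) (hJI : J < I)
    (hI : GenSqfreeGe K d I) (hJ : GenSqfreeGe K (d + 1) J)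
    (hd : 1 ≤ d) (hi : i < n - d)
    (g : Fin c → (Fin n →₀ ℕ)) (f : Fin r → (Fin n →₀ ℕ)) (b : Fin s → (Fin n →₀ ℕ))
    (hg : Function.Injective g ∧ Set.range g =
      {m : Fin n →₀ ℕ | IsSqfree m ∧ mdeg m = d + i - 1 ∧
        monomial m (1 : K) ∈ I ∧ monomial m (1 : K) ∉ J})
    (hf : Function.Injective f ∧ Set.range f =
      {m : Fin n →₀ ℕ | IsSqfree m ∧ mdeg m = d + i ∧
        monomial m (1 : K) ∈ I ∧ monomial m (1 : K) ∉ J})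
    (hb : Function.Injective b ∧ Set.range b =
      {m : Fin n →₀ ℕ | IsSqfree m ∧ mdeg m = d + i + 1 ∧
        monomial m (1 : K) ∈ I ∧ monomial m (1 : K) ∉ J})
    (hdepth : d + i < mdepth K n (quotMod I J)) :
    LinearMap.ker (Matrix.toLin' (Matrix.of fun (k : Fin s) (q : Fin r) => kSign K (f q) (b k))) =
      LinearMap.range (Matrix.toLin' (Matrix.of fun (q : Fin r) (p : Fin c) => kSign K (g p) (f q))) := by
  obtain ⟨hg1, hg2⟩ := hg
  obtain ⟨hf1, hf2⟩ := hf
  obtain ⟨hb1, hb2⟩ := hb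
  have memg : ∀ T, sqfreeExp T ∈ Set.range g ↔ T.card = d + i - 1 ∧
      monomial (sqfreeExp T) (1 : K) ∈ I ∧ monomial (sqfreeExp T) (1 : K) ∉ J := fun T => by
    simp [hg2, isSqfree_sqfreeExp, mdeg_sqfreeExp]
  have memf : ∀ T, sqfreeExp T ∈ Set.range f ↔ T.card = d + i ∧
      monomial (sqfreeExp T) (1 : K) ∈ I ∧ monomial (sqfreeExp T) (1 : K) ∉ J := fun T => by
    simp [hf2, isSqfree_sqfreeExp, mdeg_sqfreeExp]
  have memb : ∀ T, sqfreeExp T ∈ Set.range b ↔ T.card = d + i + 1 ∧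
      monomial (sqfreeExp T) (1 : K) ∈ I ∧ monomial (sqfreeExp T) (1 : K) ∉ J := fun T => by
    simp [hb2, isSqfree_sqfreeExp, mdeg_sqfreeExp]
  have eqf : ∀ q, ∃ T, sqfreeExp T = f q := fun q =>
    ⟨_, IsSqfree.sqfreeExp_support (hf2.subset ⟨q, rfl⟩).1⟩
  have eqb : ∀ k, ∃ T, sqfreeExp T = b k := fun k =>
    ⟨_, IsSqfree.sqfreeExp_support (hb2.subset ⟨k, rfl⟩).1⟩
  have mulf : ∀ (v : Fin r → K) (k : Fin s) (T : Finset (Fin n)), sqfreeExp T = b k →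
      Matrix.toLin' (Matrix.of fun (k : Fin s) (q : Fin r) => kSign K (f q) (b k)) v k =
        koszulD (1 : Fin n → K) (cochainOf f v) T := fun v k T h => by
    rw [← sum_kSign_mul, h]; rfl
  have mulg : ∀ (u : Fin c → K) (q : Fin r) (T : Finset (Fin n)), sqfreeExp T = f q →
      Matrix.toLin' (Matrix.of fun (q : Fin r) (p : Fin c) => kSign K (g p) (f q)) u q =
        koszulD (1 : Fin n → K) (cochainOf g u) T := fun u q T h => by
    rw [← sum_kSign_mul, h]; rfl
  apply le_antisymm
  · intro v hv
    have hv0 : ∀ T, monomial (sqfreeExp T) (1 : K) ∉ I → cochainOf f v T = 0 := fun T hT =>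
      cochainOf_eq_zero v fun h => hT ((memf T).mp h).2.1
    have hvI : ∀ T, monomial (sqfreeExp T) (cochainOf f v T) ∈ I := by
      intro T
      by_cases hT : monomial (sqfreeExp T) (1 : K) ∈ I
      · have := I.mul_mem_left (C (cochainOf f v T)) hT
        rwa [C_mul_monomial, mul_one] at this
      · rw [hv0 T hT, monomial_zero]
        exact I.zero_mem
    let y : Finset (Fin n) → I := fun T => ⟨_, hvI T⟩
    let N := Submodule.comap I.subtype
      (J : Submodule (MvPolynomial (Fin n) K) (MvPolynomial (Fin n) K))
    have coe_koszulD : ∀ (z : Finset (Fin n) → I) (T : Finset (Fin n)),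
        ((koszulD (X : Fin n → MvPolynomial (Fin n) K) z T : I) : MvPolynomial (Fin n) K) =
          koszulD X (fun U => (z U : MvPolynomial (Fin n) K)) T := fun z T =>
      (koszulD_map I.subtype X z T).symm
    obtain ⟨_, ⟨rs, rfl, hrs, hreg⟩, hlen⟩ := exists_lt_of_lt_csSup'
      (hdepth : d + i < sSup _)
    obtain ⟨w, hw⟩ := koszulD_exact_of_isWeaklyRegular (X : Fin n → MvPolynomial (Fin n) K) rs hrs
      hreg.toIsWeaklyRegular hlen (z := fun T => N.mkQ (y T)) (fun T hT => by
        rw [koszulD_map]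
        refine (Submodule.Quotient.mk_eq_zero _).mpr ?_
        change ((koszulD X y T : I) : MvPolynomial (Fin n) K) ∈ J
        rw [coe_koszulD, monomial_koszulD]
        by_cases hTJ : monomial (sqfreeExp T) (1 : K) ∈ J
        · have := J.mul_mem_left (C (koszulD (1 : Fin n → K) (cochainOf f v) T)) hTJ
          rwa [C_mul_monomial, mul_one] at this
        · suffices h : koszulD (1 : Fin n → K) (cochainOf f v) T = 0 by
            rw [h, monomial_zero]; exact J.zero_mem
          by_cases hTI : monomial (sqfreeExp T) (1 : K) ∈ I
          · obtain ⟨k, hk⟩ := (memb T).mpr ⟨hT, hTI, hTJ⟩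
            rw [← mulf v k T hk.symm, LinearMap.mem_ker.mp hv]
            rfl
          · rw [koszulD_congr _ (z' := 0) fun j hj => hv0 _ fun h =>
              hTI (monomial_sqfreeExp_mem_of_erase hj h), koszulD_zero])
    choose w' hw' using fun T => N.mkQ_surjective (w T)
    rw [← funext hw'] at hw
    let u : Fin c → K := fun p => coeff (g p) (w' (g p).support : MvPolynomial (Fin n) K)
    refine ⟨u, funext fun q => ?_⟩
    obtain ⟨T, hT⟩ := eqf q
    obtain ⟨hTc, hTI, hTJ⟩ := (memf T).mp ⟨q, hT.symm⟩
    have h1 : koszulD (X : Fin n → MvPolynomial (Fin n) K) w' T - y T ∈ N := by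
      rw [← Submodule.Quotient.mk_eq_zero, Submodule.Quotient.mk_sub, sub_eq_zero]
      have := hw T hTc
      rwa [koszulD_map] at this
    have h2 : coeff (sqfreeExp T)
        ((koszulD (X : Fin n → MvPolynomial (Fin n) K) w' T - y T : I) :
          MvPolynomial (Fin n) K) = 0 := by
      by_contra h
      exact hTJ (hJ.monomial_mem h1 h)
    rw [Submodule.coe_sub, coeff_sub, coe_koszulD, coeff_koszulD, sub_eq_zero, coeff_monomial,
      if_pos rfl, cochainOf_eq hf1 v hT.symm] at h2
    rw [mulg u q T hT, ← h2]
    refine koszulD_congr _ fun j hj => ?_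
    by_cases h : sqfreeExp (T.erase j) ∈ Set.range g
    · obtain ⟨p, hp⟩ := h
      rw [cochainOf_eq hg1 u hp]
      simp only [u]
      have hs : (g p).support = T.erase j := sqfreeExp_injective (by
        rw [IsSqfree.sqfreeExp_support (hg2.subset ⟨p, rfl⟩).1, hp])
      rw [hs, hp]
    · rw [cochainOf_eq_zero u h]
      by_contra hne
      exact h ((memg _).mpr ⟨by rw [Finset.card_erase_of_mem hj, hTc],
        hI.monomial_mem (w' _).2 (Ne.symm hne),
        fun h' => hTJ (monomial_sqfreeExp_mem_of_erase hj h')⟩)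
  · rintro _ ⟨u, rfl⟩
    rw [LinearMap.mem_ker]
    funext k
    obtain ⟨T, hT⟩ := eqb k
    obtain ⟨hTc, -, hTJ⟩ := (memb T).mp ⟨k, hT.symm⟩
    rw [mulf _ k T hT, Pi.zero_apply,
      ← koszulD_koszulD (1 : Fin n → K) (cochainOf g u) T]
    refine koszulD_congr _ fun j hj => ?_
    by_cases h : sqfreeExp (T.erase j) ∈ Set.range f
    · obtain ⟨q, hq⟩ := h
      rw [cochainOf_eq hf1 _ hq, mulg u q _ hq.symm]
    · rw [cochainOf_eq_zero _ h, koszulD_congr _ (z' := 0) fun l hl => ?_, koszulD_zero]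
      refine cochainOf_eq_zero u fun hm => h ((memf _).mpr ⟨?_, ?_, ?_⟩)
      · rw [Finset.card_erase_of_mem hj, hTc, Nat.add_sub_cancel]
      · exact monomial_sqfreeExp_mem_of_erase hl ((memg _).mp hm).2.1
      · exact fun h' => hTJ (monomial_sqfreeExp_mem_of_erase hj h')
end
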